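/- Let a, b, c, e be real numbers with 0 < a < b < 1 and 0 < c < e < 1. Then (b − a)·( e·d(a·c, b·c) / d(a·e, b·e) − c ) + (e − c)·( b·d(a·c, a·e) / d(b·c, b·e) − b ) < 0. -/

import Mathlib

/-- The Kullback-Leibler divergence between Bernoulli random variables with
means `p` and `q`. -/
noncomputable def klBer (p q : ℝ) : ℝ :=
  p * Real.log (p / q) + (1 - p) * Real.log ((1 - p) / (1 - q))

theorem klBer_pos {p q : ℝ} (hp : 0 < p) (hpq : p < q) (hq : q < 1) : 0 < klBer p q := by
  have hq0 : 0 < q := hp.trans hpq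
  have h1p : 0 < 1 - p := by linarith
  have h1q : 0 < 1 - q := by linarith
  have h1 : Real.log (q / p) < q / p - 1 :=
    Real.log_lt_sub_one_of_pos (by positivity) ((one_lt_div hp).2 hpq).ne'
  have h2 : Real.log ((1 - q) / (1 - p)) < (1 - q) / (1 - p) - 1 :=
    Real.log_lt_sub_one_of_pos (by positivity) ((div_lt_one h1p).2 (by linarith)).ne
  have h3 := mul_lt_mul_of_pos_left h1 hp
  have h4 := mul_lt_mul_of_pos_left h2 h1p
  have e1 : p * (q / p - 1) = q - p := by field_simp
  have e2 : (1 - p) * ((1 - q) / (1 - p) - 1) = p - q := by field_simp; ring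
  rw [e1, Real.log_div hq0.ne' hp.ne'] at h3
  rw [e2, Real.log_div h1q.ne' h1p.ne'] at h4
  rw [klBer, Real.log_div hp.ne' hq0.ne', Real.log_div h1p.ne' h1q.ne']
  linarith

theorem strictMonoOn_mul_log_sub_log {p q : ℝ} (hpq : p < q) (hq : q < 1) :
    StrictMonoOn (fun x : ℝ => (1 / x - p) * (Real.log (1 - p * x) - Real.log (1 - q * x)))
      (Set.Ioo 0 1) := by
  have hderiv : ∀ x ∈ Set.Ioo (0 : ℝ) 1, ∃ f', 0 < f' ∧ HasDerivAt
      (fun x : ℝ => (1 / x - p) * (Real.log (1 - p * x) - Real.log (1 - q * x))) f' x := by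
    rintro x ⟨hx0, hx1⟩
    have hpx : 0 < 1 - p * x := by nlinarith
    have hqx : 0 < 1 - q * x := by nlinarith
    have hlin (r : ℝ) : HasDerivAt (fun x : ℝ => 1 - r * x) (-r) x := by
      simpa using ((hasDerivAt_id x).const_mul r).const_sub 1
    have hinv : HasDerivAt (fun x : ℝ => 1 / x - p) (-(x ^ 2)⁻¹) x := by
      simpa using (hasDerivAt_inv hx0.ne').sub_const p
    refine ⟨_, ?_, hinv.mul (((hlin p).log hpx.ne').sub ((hlin q).log hqx.ne'))⟩
    have hu : 1 < (1 - p * x) / (1 - q * x) := (one_lt_div hqx).2 (by nlinarith)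
    have hlog := Real.log_lt_sub_one_of_pos (by positivity) hu.ne'
    rw [Real.log_div hpx.ne' hqx.ne'] at hlog
    have hscale := mul_lt_mul_of_pos_left hlog (show 0 < (x ^ 2)⁻¹ by positivity)
    have heq : (1 / x - p) * (-p / (1 - p * x) - -q / (1 - q * x)) =
        (x ^ 2)⁻¹ * ((1 - p * x) / (1 - q * x) - 1) := by
      have hpx' := hpx.ne'
      have hqx' := hqx.ne'
      rw [div_sub_div _ _ hpx' hqx', div_sub_one hqx', div_sub' hx0.ne',
        div_mul_div_comm, inv_mul_eq_div, div_div,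
        div_eq_div_iff (by positivity) (by positivity)]
      ring
    rw [heq]
    linarith
  refine strictMonoOn_of_deriv_pos (convex_Ioo 0 1) (fun x hx => ?_) (fun x hx => ?_)
  · obtain ⟨f', -, h⟩ := hderiv x hx
    exact h.continuousAt.continuousWithinAt
  · rw [interior_Ioo] at hx
    obtain ⟨f', hf', h⟩ := hderiv x hx
    rwa [h.deriv]

theorem mul_klBer_mul_lt {p q x y : ℝ} (hp : 0 < p) (hpq : p < q) (hq : q < 1)
    (hx : 0 < x) (hxy : x < y) (hy : y < 1) :
    y * klBer (p * x) (q * x) < x * klBer (p * y) (q * y) := by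
  have key (z : ℝ) (hz : 0 < z) (hz1 : z < 1) : klBer (p * z) (q * z) =
      z * (p * Real.log (p / q) +
        (1 / z - p) * (Real.log (1 - p * z) - Real.log (1 - q * z))) := by
    have hpz : 0 < 1 - p * z := by nlinarith
    have hqz : 0 < 1 - q * z := by nlinarith
    rw [klBer, mul_div_mul_right _ _ hz.ne', Real.log_div hpz.ne' hqz.ne']
    field_simp
  have hy0 := hx.trans hxy
  have h := strictMonoOn_mul_log_sub_log hpq hq ⟨hx, hxy.trans hy⟩ ⟨hy0, hy⟩ hxy
  rw [key x hx (hxy.trans hy), key y hy0 hy, mul_left_comm]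
  have := mul_lt_mul_of_pos_left h (mul_pos hx hy0)
  dsimp only at this
  linarith

theorem mass_redistribution_neg (a b c e : ℝ)
    (ha : 0 < a) (hab : a < b) (hb1 : b < 1)
    (hc : 0 < c) (hce : c < e) (he1 : e < 1) :
    (b - a) * (e * klBer (a * c) (b * c) / klBer (a * e) (b * e) - c)
      + (e - c) * (b * klBer (a * c) (a * e) / klBer (b * c) (b * e) - b)
      < 0 := by
  have hb := ha.trans hab
  have he := hc.trans hce
  have hrow : 0 < klBer (a * e) (b * e) :=
    klBer_pos (by positivity) (by nlinarith) (by nlinarith)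
  have hcol : 0 < klBer (b * c) (b * e) :=
    klBer_pos (by positivity) (by nlinarith) (by nlinarith)
  have h1 := mul_klBer_mul_lt ha hab hb1 hc hce he1
  have h2 := mul_klBer_mul_lt hc hce he1 ha hab hb1
  rw [mul_comm c a, mul_comm e a, mul_comm c b, mul_comm e b] at h2
  have h3 : b * klBer (a * c) (a * e) < b * klBer (b * c) (b * e) :=
    h2.trans (mul_lt_mul_of_pos_right hab hcol)
  refine add_neg (mul_neg_of_pos_of_neg (sub_pos.2 hab) (sub_neg.2 ?_))
    (mul_neg_of_pos_of_neg (sub_pos.2 hce) (sub_neg.2 ?_))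
  · exact (div_lt_iff₀ hrow).2 h1
  · exact (div_lt_iff₀ hcol).2 h3
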